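/- Let G be a group such that Inn(G) is infinite. If Aut(G) is acylindrically hyperbolic, then every subgroup of Aut(G) that contains Inn(G) is acylindrically hyperbolic. -/

import Mathlib

noncomputable section

open Metric Set

universe u v

/-- A geodesic metric space: any two points are joined by an isometrically
parametrized segment. -/
def GeodesicSpace (Y : Type*) [MetricSpace Y] : Prop :=
  ∀ x y : Y, ∃ f : ℝ → Y, f 0 = x ∧ f (dist x y) = y ∧
    ∀ s ∈ Set.Icc (0:ℝ) (dist x y), ∀ t ∈ Set.Icc (0:ℝ) (dist x y),
      dist (f s) (f t) = |s - t|

/-- Gromov hyperbolicity (four-point condition) with constant `δ`. -/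
def GromovHyperbolic (Y : Type*) [MetricSpace Y] (δ : ℝ) : Prop :=
  ∀ x y z w : Y, dist x y + dist z w ≤ max (dist x z + dist y w) (dist x w + dist y z) + 2 * δ

/-- A Gromov hyperbolic geodesic metric space. -/
def HyperbolicGeodesicSpace (Y : Type*) [MetricSpace Y] : Prop :=
  GeodesicSpace Y ∧ ∃ δ : ℝ, 0 ≤ δ ∧ GromovHyperbolic Y δ

/-- An isometric action `ρ` of `G` on `Y` is acylindrical if for every `R > 0` there are
`L > 0` and `N` such that for any two points at distance `> L`, at most `N` elements of `G`
move both points by less than `R`. -/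
def IsAcylindrical {G : Type*} [Group G] {Y : Type*} [MetricSpace Y] (ρ : G →* (Y ≃ᵢ Y)) : Prop :=
  ∀ R : ℝ, 0 < R → ∃ L : ℝ, 0 < L ∧ ∃ N : ℕ, ∀ x y : Y, L < dist x y →
    ∃ s : Finset G, s.card ≤ N ∧
      ∀ g : G, dist x (ρ g x) < R → dist y (ρ g y) < R → g ∈ s

/-- A group is virtually cyclic if it has a cyclic subgroup of finite index. -/
def VirtuallyCyclic (G : Type*) [Group G] : Prop :=
  ∃ H : Subgroup G, H.FiniteIndex ∧ IsCyclic ↥H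

/-- A group is acylindrically hyperbolic if it is not virtually cyclic and admits an
acylindrical isometric action with unbounded orbits on a Gromov hyperbolic geodesic space
(this is equivalent to admitting a nonelementary acylindrical action on such a space). -/
def AcylindricallyHyperbolic (G : Type u) [Group G] : Prop :=
  ¬ VirtuallyCyclic G ∧
    ∃ (Y : Type u) (_ : MetricSpace Y) (ρ : G →* (Y ≃ᵢ Y)),
      HyperbolicGeodesicSpace Y ∧ IsAcylindrical ρ ∧
      ∃ y : Y, ¬ Bornology.IsBounded (Set.range fun g : G => ρ g y)



section helpers
variable {H : Type*} [Group H] {Y : Type*} [MetricSpace Y]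

lemma aux_dist (ρ : H →* (Y ≃ᵢ Y)) (x : Y) (g h : H) :
    dist (ρ g x) (ρ h x) = dist x (ρ (g⁻¹ * h) x) := by
  have h1 := (ρ g).dist_eq x (ρ (g⁻¹ * h) x)
  have h2 : ρ g (ρ (g⁻¹ * h) x) = ρ h x := by
    rw [← IsometryEquiv.mul_apply, ← map_mul, mul_inv_cancel_left]
  rw [← h1, h2]

lemma aux_inv (ρ : H →* (Y ≃ᵢ Y)) (x : Y) (g : H) :
    dist x (ρ g⁻¹ x) = dist x (ρ g x) := by
  have := aux_dist ρ x g 1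
  simp only [map_one, mul_one] at this
  rw [← this, dist_comm]; rfl

lemma aux_four (ρ : H →* (Y ≃ᵢ Y)) {δ : ℝ} (hδ : GromovHyperbolic Y δ) (x : Y) (g h k l : H) :
    dist x (ρ (g⁻¹ * h) x) + dist x (ρ (k⁻¹ * l) x) ≤
      max (dist x (ρ (g⁻¹ * k) x) + dist x (ρ (h⁻¹ * l) x))
        (dist x (ρ (g⁻¹ * l) x) + dist x (ρ (h⁻¹ * k) x)) + 2 * δ := by
  have := hδ (ρ g x) (ρ h x) (ρ k x) (ρ l x)
  simpa only [aux_dist] using this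

lemma lox_growth (ρ : H →* (Y ≃ᵢ Y)) {δ : ℝ} (h0 : 0 ≤ δ) (hδ : GromovHyperbolic Y δ) (x : Y)
    (g : H) (hg : dist x (ρ g x) + 4 * δ < dist x (ρ (g ^ 2) x)) (n : ℕ) :
    dist x (ρ (g ^ n) x) + (dist x (ρ (g ^ 2) x) - dist x (ρ g x) - 2 * δ)
      ≤ dist x (ρ (g ^ (n + 1)) x) := by
  induction n with
  | zero =>
    have h1 := dist_triangle x (ρ g x) (ρ (g ^ 2) x)
    rw [aux_dist] at h1
    have : g⁻¹ * g ^ 2 = g := by group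
    rw [this] at h1
    simp only [pow_zero, map_one, zero_add, pow_one]
    have : dist x ((1 : Y ≃ᵢ Y) x) = 0 := dist_self x
    linarith
  | succ n ih =>
    have h4 := aux_four ρ hδ x 1 (g ^ 2) g (g ^ (n + 2))
    have e1 : (1 : H)⁻¹ * g ^ 2 = g ^ 2 := by simp
    have e2 : g⁻¹ * g ^ (n + 2) = g ^ (n + 1) := by rw [pow_succ' g (n+1)]; group
    have e3 : (1 : H)⁻¹ * g = g := by simp
    have e4 : (g ^ 2)⁻¹ * g ^ (n + 2) = g ^ n := by rw [add_comm, pow_add]; group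
    have e5 : (1 : H)⁻¹ * g ^ (n + 2) = g ^ (n + 2) := by simp
    have e6 : (g ^ 2)⁻¹ * g = g⁻¹ := by group
    rw [e1, e2, e3, e4, e5, e6, aux_inv] at h4
    rcases le_max_iff.1 (sub_le_iff_le_add.2 h4) with h | h
    · linarith
    · show _ ≤ dist x (ρ (g ^ (n + 2)) x)
      linarith

lemma lox_linear (ρ : H →* (Y ≃ᵢ Y)) {δ : ℝ} (h0 : 0 ≤ δ) (hδ : GromovHyperbolic Y δ) (x : Y)
    (g : H) (hg : dist x (ρ g x) + 4 * δ < dist x (ρ (g ^ 2) x)) (n : ℕ) :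
    n * (dist x (ρ (g ^ 2) x) - dist x (ρ g x) - 2 * δ) ≤ dist x (ρ (g ^ n) x) := by
  induction n with
  | zero => simp
  | succ n ih =>
    have := lox_growth ρ h0 hδ x g hg n
    push_cast
    linarith

/-- far bound on one side -/
lemma lox_side (ρ : H →* (Y ≃ᵢ Y)) {δ : ℝ} (h0 : 0 ≤ δ) (hδ : GromovHyperbolic Y δ) (x : Y)
    (g c : H) (hg : dist x (ρ g x) + 4 * δ < dist x (ρ (g ^ 2) x))
    (hc : dist x (ρ c x) ≤ dist x (ρ (g⁻¹ * c) x)) (n : ℕ) :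
    dist x (ρ c x) + dist x (ρ (g ^ (n + 1)) x) - dist x (ρ g x) - 2 * δ
      ≤ dist x (ρ ((g ^ (n + 1))⁻¹ * c) x) := by
  have hgr := lox_growth ρ h0 hδ x g hg n
  have h4 := aux_four ρ hδ x g c 1 (g ^ (n + 1))
  have e1 : (1 : H)⁻¹ * g ^ (n + 1) = g ^ (n + 1) := by simp
  have e2 : g⁻¹ * g ^ (n + 1) = g ^ n := by rw [pow_succ' g n]; group
  have e3 : c⁻¹ * 1 = c⁻¹ := by simp
  have e4 : g⁻¹ * 1 = g⁻¹ := by simp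
  have e5 : c⁻¹ * g ^ (n + 1) = ((g ^ (n + 1))⁻¹ * c)⁻¹ := by group
  rw [e1, e2, e3, e4, e5, aux_inv, aux_inv, aux_inv] at h4
  rcases le_max_iff.1 (sub_le_iff_le_add.2 h4) with h | h
  · linarith
  · linarith

lemma lox_close_of_min (ρ : H →* (Y ≃ᵢ Y)) {δ : ℝ} (h0 : 0 ≤ δ) (hδ : GromovHyperbolic Y δ) (x : Y)
    (g c : H) (hg : dist x (ρ g x) + 4 * δ < dist x (ρ (g ^ 2) x)) (hcomm : Commute g c)
    (hc : dist x (ρ c x) ≤ dist x (ρ (g⁻¹ * c) x))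
    (hc' : dist x (ρ c x) ≤ dist x (ρ (g * c) x)) :
    dist x (ρ c x) ≤ dist x (ρ g x) + 3 * δ := by
  set e := dist x (ρ (g ^ 2) x) - dist x (ρ g x) - 2 * δ with he
  have hepos : 0 < e := by linarith
  obtain ⟨n, hn⟩ := exists_nat_gt ((dist x (ρ c x)) / e)
  rw [div_lt_iff₀ hepos] at hn
  have hlin := lox_linear ρ h0 hδ x g hg (n + 1)
  rw [← he] at hlin
  push_cast at hlin
  have s1 := lox_side ρ h0 hδ x g c hg hc n
  have s2 := lox_side ρ h0 hδ x g⁻¹ c (by rw [inv_pow, aux_inv, aux_inv]; exact hg)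
    (by rw [inv_inv]; exact hc') n
  rw [inv_pow, aux_inv, aux_inv, inv_inv] at s2
  set p := g ^ (n + 1) with hp
  have hpc : Commute p c := hcomm.pow_left _
  have h4 := aux_four ρ hδ x p c 1 (c * p)
  have e1 : (1 : H)⁻¹ * (c * p) = p * c := by rw [hpc.eq]; simp
  have e2 : c⁻¹ * (c * p) = p := by group
  have e3 : p⁻¹ * (c * p) = c := by rw [← hpc.eq]; group
  have e4 : c⁻¹ * 1 = c⁻¹ := by simp
  have e5 : p⁻¹ * 1 = p⁻¹ := by simp
  rw [e1, e2, e3, e4, e5, aux_inv, aux_inv] at h4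
  rcases le_max_iff.1 (sub_le_iff_le_add.2 h4) with h | h
  · linarith
  · linarith

lemma lox_close (ρ : H →* (Y ≃ᵢ Y)) {δ : ℝ} (h0 : 0 ≤ δ) (hδ : GromovHyperbolic Y δ) (x : Y)
    (g c : H) (hg : dist x (ρ g x) + 4 * δ < dist x (ρ (g ^ 2) x)) (hcomm : Commute g c) :
    ∃ n : ℤ, dist x (ρ (g ^ n * c) x) ≤ dist x (ρ g x) + 3 * δ := by
  set e := dist x (ρ (g ^ 2) x) - dist x (ρ g x) - 2 * δ with he
  have hepos : 0 < e := by linarith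
  obtain ⟨M, hM⟩ := exists_nat_gt ((2 * dist x (ρ c x)) / e)
  rw [div_lt_iff₀ hepos] at hM
  have hlow : ∀ n : ℤ, n.natAbs * e - dist x (ρ c x) ≤ dist x (ρ (g ^ n * c) x) := by
    intro n
    have h1 : dist x (ρ (g ^ n) x) = dist x (ρ (g ^ n.natAbs) x) := by
      rcases Int.natAbs_eq n with h | h
      · conv_lhs => rw [h]
        rw [zpow_natCast]
      · conv_lhs => rw [h]
        rw [zpow_neg, zpow_natCast, aux_inv]
    have h2 := lox_linear ρ h0 hδ x g hg n.natAbs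
    have h3 := dist_triangle x (ρ (g ^ n * c) x) (ρ (g ^ n) x)
    rw [aux_dist ρ x (g ^ n * c)] at h3
    have : (g ^ n * c)⁻¹ * g ^ n = c⁻¹ := by group
    rw [this, aux_inv] at h3
    linarith
  obtain ⟨m, hm, hmin⟩ := Finset.exists_min_image (Finset.Icc (-(M:ℤ)) M)
    (fun n : ℤ => dist x (ρ (g ^ n * c) x)) ⟨0, by simp⟩
  have hall : ∀ n : ℤ, dist x (ρ (g ^ m * c) x) ≤ dist x (ρ (g ^ n * c) x) := by
    intro n
    by_cases hn : n ∈ Finset.Icc (-(M:ℤ)) M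
    · exact hmin n hn
    · have h1 := hmin 0 (by simp)
      have h2 := hlow n
      have h3 : M ≤ n.natAbs := by
        simp only [Finset.mem_Icc, not_and_or, not_le] at hn; omega
      have h4 : (M : ℝ) * e ≤ n.natAbs * e := by
        have : (M : ℝ) ≤ n.natAbs := by exact_mod_cast h3
        gcongr
      simp only [zpow_zero, one_mul] at h1
      linarith
  refine ⟨m, lox_close_of_min ρ h0 hδ x g _ hg ((Commute.refl g).zpow_right m |>.mul_right hcomm) ?_ ?_⟩
  · have := hall (m - 1)
    rwa [sub_eq_neg_add, zpow_add, zpow_neg_one, mul_assoc] at this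
  · have := hall (1 + m)
    rwa [zpow_add, zpow_one, mul_assoc] at this

/-- Middle points of a segment are moved close to the segment -/
lemma mid_move {δ σ D : ℝ} (h0 : 0 ≤ δ) (hδ : GromovHyperbolic Y δ) (φ : Y ≃ᵢ Y) (y z u : Y)
    (hy : dist y (φ y) ≤ D) (hz : dist z (φ z) ≤ D)
    (hu : dist y u + dist u z ≤ dist y z + σ)
    (h1 : D + σ + 2 * δ < dist y u) (h2 : D + σ + 2 * δ < dist u z) :
    dist y (φ u) + dist (φ u) z ≤ dist y z + σ + 6 * δ ∧
    dist y (φ u) - dist y u ≤ dist y (φ z) - dist y z + 2 * δ ∧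
    dist y (φ z) - dist y z - σ - 4 * δ ≤ dist y (φ u) - dist y u := by
  have q1 := hδ y (φ u) (φ y) (φ z)
  have q2 := hδ z (φ u) (φ y) (φ z)
  have q3 := hδ y (φ z) (φ y) z
  have i1 := φ.dist_eq y u
  have i2 := φ.dist_eq u z
  have i3 := φ.dist_eq y z
  have t1 := dist_triangle y u z
  have t2 := dist_triangle y (φ u) z
  have t3 := dist_triangle (φ y) y (φ u)
  have t4 := dist_triangle (φ u) z (φ z)
  have c1 := dist_comm (φ y) (φ u)
  have c2 := dist_comm (φ y) y
  have c3 := dist_comm z (φ u)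
  have c4 := dist_comm z (φ z)
  have c5 := dist_comm z (φ y)
  have c6 := dist_comm (φ z) (φ y)
  have D0 : 0 ≤ D := dist_nonneg.trans hy
  have q1' : dist y (φ u) ≤ dist y (φ z) + dist y u - dist y z + 2 * δ := by
    rcases le_max_iff.1 (sub_le_iff_le_add.2 q1) with h | h <;> linarith
  have q2' : dist (φ u) z ≤ dist (φ y) z + dist u z - dist y z + 2 * δ := by
    rcases le_max_iff.1 (sub_le_iff_le_add.2 q2) with h | h <;> linarith
  have q3' : dist y (φ z) + dist (φ y) z ≤ 2 * dist y z + 2 * δ := by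
    rcases le_max_iff.1 (sub_le_iff_le_add.2 q3) with h | h <;> linarith
  refine ⟨?_, ?_, ?_⟩ <;> linarith

lemma mid_small {δ D : ℝ} (h0 : 0 ≤ δ) (hδ : GromovHyperbolic Y δ) (φ : Y ≃ᵢ Y) (y z u : Y)
    (hy : dist y (φ y) ≤ D) (hz : dist z (φ z) ≤ D)
    (hu : dist y u + dist u z = dist y z)
    (h1 : 2 * D + 8 * δ < dist y u) (h2 : 2 * D + 8 * δ < dist u z)
    (hn : dist u (φ (φ u)) ≤ dist u (φ u) + 4 * δ) : dist u (φ u) ≤ 42 * δ := by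
  have D0 : 0 ≤ D := dist_nonneg.trans hy
  obtain ⟨a1, a2, a3⟩ := mid_move (σ := 0) h0 hδ φ y z u hy hz (by linarith) (by linarith)
    (by linarith)
  have i1 := φ.dist_eq y u
  have i2 := φ.dist_eq u z
  have t3 := dist_triangle (φ y) y (φ u)
  have t4 := dist_triangle (φ u) z (φ z)
  have c2 := dist_comm (φ y) y
  obtain ⟨b1, b2, b3⟩ := mid_move (σ := 6 * δ) h0 hδ φ y z (φ u) hy hz (by linarith) (by linarith)
    (by linarith)
  have q := hδ u (φ u) y z
  have c3 := dist_comm u y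
  have c4 := dist_comm (φ u) y
  have r1 := dist_triangle y u (φ (φ u))
  have r2 := dist_triangle y (φ (φ u)) u
  have c5 := dist_comm (φ (φ u)) u
  rcases le_max_iff.1 (sub_le_iff_le_add.2 q) with h | h
  · linarith
  · linarith

lemma exists_lox (ρ : H →* (Y ≃ᵢ Y)) {δ : ℝ} (h0 : 0 ≤ δ) (hδ : GromovHyperbolic Y δ)
    (hgeo : GeodesicSpace Y) (hac : IsAcylindrical ρ) (s : H) (hs : orderOf s = 0) (y : Y)
    (hunb : ∀ B : ℝ, ∃ k : ℤ, B < dist y (ρ (s ^ k) y)) :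
    ∃ (i : ℕ) (x : Y), dist x (ρ (s ^ i) x) + 4 * δ < dist x (ρ ((s ^ i) ^ 2) x) := by
  by_contra hcon
  push Not at hcon
  obtain ⟨L, hL, N, hN⟩ := hac (42 * δ + 1) (by linarith)
  set D := ∑ i ∈ Finset.range (N + 1), dist y (ρ (s ^ i) y) with hD
  have hDi : ∀ i ∈ Finset.range (N + 1), dist y (ρ (s ^ i) y) ≤ D := fun i hi =>
    Finset.single_le_sum (f := fun i => dist y (ρ (s ^ i) y)) (fun _ _ => dist_nonneg) hi
  have D0 : 0 ≤ D := Finset.sum_nonneg fun _ _ => dist_nonneg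
  set t := 2 * D + 8 * δ + 1 with ht
  obtain ⟨k, hk⟩ := hunb (2 * t + L + 1)
  set z := ρ (s ^ k) y with hz
  obtain ⟨f, f0, f1, hf⟩ := hgeo y z
  have hpt : ∀ r, t ≤ r → r ≤ dist y z - t → dist y (f r) = r ∧ dist (f r) z = dist y z - r := by
    intro r hr hr'
    have m0 : (0:ℝ) ∈ Set.Icc (0:ℝ) (dist y z) := ⟨le_rfl, dist_nonneg⟩
    have m1 : dist y z ∈ Set.Icc (0:ℝ) (dist y z) := ⟨dist_nonneg, le_rfl⟩
    have mr : r ∈ Set.Icc (0:ℝ) (dist y z) := ⟨by linarith, by linarith⟩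
    have e1 := hf 0 m0 r mr
    have e2 := hf r mr _ m1
    rw [f0, abs_of_nonpos (by linarith)] at e1
    rw [f1, abs_of_nonpos (by linarith)] at e2
    exact ⟨by linarith, by linarith⟩
  have hsmall : ∀ r, t ≤ r → r ≤ dist y z - t → ∀ i ∈ Finset.range (N + 1),
      dist (f r) (ρ (s ^ i) (f r)) < 42 * δ + 1 := by
    intro r hr hr' i hi
    obtain ⟨p1, p2⟩ := hpt r hr hr'
    have hzz : dist z (ρ (s ^ i) z) ≤ D := by
      have : ρ (s ^ i) z = ρ (s ^ k) (ρ (s ^ i) y) := by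
        rw [hz, ← IsometryEquiv.mul_apply, ← IsometryEquiv.mul_apply, ← map_mul, ← map_mul]
        congr 2
        exact ((Commute.refl s).pow_left i).zpow_right k
      rw [this, hz, (ρ (s ^ k)).dist_eq]
      exact hDi i hi
    have := mid_small h0 hδ (ρ (s ^ i)) y z (f r) (hDi i hi) hzz (by linarith) (by linarith)
      (by linarith) (by
        have := hcon i (f r)
        rwa [pow_two, map_mul, IsometryEquiv.mul_apply] at this)
    linarith
  obtain ⟨S, hS, hS'⟩ := hN (f t) (f (t + L + 1)) (by
    rw [hf t ⟨by linarith, by linarith⟩ _ ⟨by linarith, by linarith⟩, abs_of_nonpos] <;> linarith)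
  classical
  have hsub : (Finset.range (N + 1)).image (fun i => s ^ i) ⊆ S := by
    intro g hg
    obtain ⟨i, hi, rfl⟩ := Finset.mem_image.1 hg
    exact hS' _ (hsmall t le_rfl (by linarith) i hi)
      (hsmall (t + L + 1) (by linarith) (by linarith) i hi)
  have hcard := Finset.card_le_card hsub
  rw [Finset.card_image_of_injective _ (fun a b h => injective_pow_iff_not_isOfFinOrder.2
    (orderOf_eq_zero_iff.1 hs) h), Finset.card_range] at hcard
  omega

lemma normal_unbounded (ρ : H →* (Y ≃ᵢ Y)) (hac : IsAcylindrical ρ) (y : Y)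
    (hunb : ¬ Bornology.IsBounded (Set.range fun g : H => ρ g y))
    (N : Subgroup H) [hN : N.Normal] [Infinite N] (B : ℝ) : ∃ n ∈ N, B < dist y (ρ n y) := by
  by_contra hcon
  push Not at hcon
  have hB : 0 ≤ B := dist_nonneg.trans (hcon 1 N.one_mem)
  obtain ⟨L, hL, M, hM⟩ := hac (B + 1) (by linarith)
  obtain ⟨g, hg⟩ : ∃ g : H, L < dist y (ρ g y) := by
    by_contra h
    push Not at h
    apply hunb
    refine (Metric.isBounded_closedBall (x := y) (r := L)).subset ?_
    rintro _ ⟨g, rfl⟩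
    rw [Metric.mem_closedBall, dist_comm]
    exact h g
  obtain ⟨S, -, hS⟩ := hM y (ρ g y) hg
  have : (N : Set H) ⊆ S := by
    intro n hn
    refine hS n (by linarith [hcon n hn]) ?_
    have h1 : ρ n (ρ g y) = ρ (n * g) y := by rw [map_mul]; rfl
    rw [h1, aux_dist]
    have := hcon (g⁻¹ * (n * g)) (by
      have := hN.conj_mem n hn g⁻¹
      rwa [inv_inv, mul_assoc] at this)
    linarith
  exact Set.infinite_coe_iff.1 ‹Infinite N› (S.finite_toSet.subset this)

/-- No infinite cyclic normal subgroup unless virtually cyclic. -/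
lemma virtuallyCyclic_of_normal (ρ : H →* (Y ≃ᵢ Y)) (hY : HyperbolicGeodesicSpace Y)
    (hac : IsAcylindrical ρ) (y : Y)
    (hunb : ¬ Bornology.IsBounded (Set.range fun g : H => ρ g y))
    (s : H) (hs : orderOf s = 0) (hn : (Subgroup.zpowers s).Normal) : VirtuallyCyclic H := by
  obtain ⟨hgeo, δ, h0, hδ⟩ := hY
  have hinj : Function.Injective fun n : ℤ => s ^ n :=
    injective_zpow_iff_not_isOfFinOrder.2 (orderOf_eq_zero_iff.1 hs)
  have : Infinite (Subgroup.zpowers s) := by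
    rw [← SetLike.coe_sort_coe, Set.infinite_coe_iff]
    exact (Set.infinite_range_of_injective hinj)
  have hu : ∀ x : Y, ∀ B : ℝ, ∃ k : ℤ, B < dist x (ρ (s ^ k) x) := by
    intro x B
    obtain ⟨n, ⟨k, rfl⟩, hk⟩ := normal_unbounded ρ hac y hunb (Subgroup.zpowers s)
      (B + 2 * dist x y)
    refine ⟨k, ?_⟩
    have h1 := dist_triangle4 y x (ρ (s ^ k) x) (ρ (s ^ k) y)
    rw [(ρ (s ^ k)).dist_eq x y, dist_comm y x] at h1
    simp only at hk
    linarith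
  obtain ⟨i, x, hx⟩ := exists_lox ρ h0 hδ hgeo hac s hs y (hu y)
  set g := s ^ i with hg
  -- finiteness
  obtain ⟨L, hL, M, hM⟩ := hac (dist x (ρ g x) + 3 * δ + 1)
    (by have := dist_nonneg (x := x) (y := ρ g x); linarith)
  obtain ⟨k, hk⟩ := hu x L
  obtain ⟨S, -, hS⟩ := hM x (ρ (s ^ k) x) hk
  have hcov : ∀ c : H, Commute s c → ∃ n : ℤ, g ^ n * c ∈ S := by
    intro c hc
    obtain ⟨n, hn⟩ := lox_close ρ h0 hδ x g c hx (hc.pow_left i)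
    refine ⟨n, hS _ (by linarith) ?_⟩
    have h1 : ρ (g ^ n * c) (ρ (s ^ k) x) = ρ (g ^ n * c * s ^ k) x := by
      rw [map_mul ρ _ (s ^ k)]; rfl
    have hc2 : Commute (s ^ k) (g ^ n * c) :=
      ((((Commute.refl s).pow_right i).zpow_right n).mul_right hc).zpow_left k
    rw [h1, aux_dist, ← hc2.eq, inv_mul_cancel_left]
    linarith
  have hpm : ∀ h : H, h⁻¹ * s * h = s ∨ h⁻¹ * s * h = s⁻¹ := by
    intro h
    obtain ⟨a, ha⟩ := hn.conj_mem s (Subgroup.mem_zpowers s) h⁻¹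
    obtain ⟨b, hb⟩ := hn.conj_mem s (Subgroup.mem_zpowers s) h
    simp only [inv_inv] at ha hb
    have hab : s ^ (b * a) = s ^ (1 : ℤ) := by
      rw [zpow_mul, hb, conj_zpow, ha]; group
    have h1 := hinj hab
    rcases Int.eq_one_or_neg_one_of_mul_eq_one' h1 with ⟨-, h2⟩ | ⟨-, h2⟩
    · left; rw [← ha, h2, zpow_one]
    · right; rw [← ha, h2, zpow_neg_one]
  refine ⟨Subgroup.zpowers g, ?_, inferInstance⟩
  classical
  obtain ⟨q, hq⟩ : ∃ q : H, ∀ h : H, Commute s h ∨ Commute s (h * q) := by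
    by_cases hall : ∀ h, Commute s h
    · exact ⟨1, fun h => Or.inl (hall h)⟩
    · push Not at hall
      obtain ⟨q, hq⟩ := hall
      have key : ∀ h : H, h⁻¹ * s * h = s → Commute s h := by
        intro h hh
        show s * h = h * s
        conv_rhs => rw [← hh]
        group
      refine ⟨q, fun h => ?_⟩
      rcases hpm h with h1 | h1
      · exact Or.inl (key h h1)
      · right
        rcases hpm q with h2 | h2
        · exact absurd (key q h2) hq
        · apply key
          have : (h * q)⁻¹ * s * (h * q) = q⁻¹ * (h⁻¹ * s * h) * q := by group
          rw [this, h1]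
          have : q⁻¹ * s⁻¹ * q = (q⁻¹ * s * q)⁻¹ := by group
          rw [this, h2, inv_inv]
  have hfin : Finite (H ⧸ Subgroup.zpowers g) := by
    have hT : ((fun h : H => (QuotientGroup.mk h⁻¹ : H ⧸ Subgroup.zpowers g)) ''
        ((S : Set H) ∪ (fun a => a * q⁻¹) '' S)).Finite :=
      (S.finite_toSet.union (S.finite_toSet.image _)).image _
    refine Set.finite_univ_iff.1 (hT.subset ?_)
    intro w _
    obtain ⟨h, rfl⟩ := QuotientGroup.mk_surjective w
    rcases hq h⁻¹ with hc | hc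
    · obtain ⟨n, hn⟩ := hcov _ hc
      refine ⟨g ^ n * h⁻¹, Or.inl hn, ?_⟩
      simp only
      rw [QuotientGroup.eq]
      exact ⟨n, by simp⟩
    · obtain ⟨n, hn⟩ := hcov _ hc
      refine ⟨g ^ n * h⁻¹, Or.inr ⟨_, hn, by group⟩, ?_⟩
      simp only
      rw [QuotientGroup.eq]
      exact ⟨n, by simp⟩
  exact Subgroup.finiteIndex_of_finite_quotient

lemma exists_cyclic_normal (N A : Subgroup H) [hNn : N.Normal] (hinf : Infinite N) (hle : N ≤ A)
    (hA : VirtuallyCyclic A) : ∃ s : H, orderOf s = 0 ∧ (Subgroup.zpowers s).Normal := by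
  obtain ⟨V, hV, hVc⟩ := hA
  obtain ⟨t, ht⟩ := hVc.exists_generator
  have hAinf : Infinite A := Infinite.of_injective _ (Subgroup.inclusion_injective hle)
  have hVinf : Infinite V := by
    by_contra h
    rw [not_infinite_iff_finite] at h
    have h1 := V.card_mul_index
    have : Nat.card A ≠ 0 := by
      rw [← h1]; exact mul_ne_zero Nat.card_pos.ne' hV.index_ne_zero
    exact this Nat.card_eq_zero_of_infinite
  have hto : orderOf t = 0 := Infinite.orderOf_eq_zero_of_forall_mem_zpowers ht
  set T : H := ((t : A) : H) with hT
  have hTo : orderOf T = 0 := by rw [hT, Subgroup.orderOf_coe, Subgroup.orderOf_coe, hto]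
  have hTinj : Function.Injective fun n : ℤ => T ^ n :=
    injective_zpow_iff_not_isOfFinOrder.2 (orderOf_eq_zero_iff.1 hTo)
  have hVT : ∀ a : A, a ∈ V → ∃ k : ℤ, T ^ k = a := by
    intro a ha
    obtain ⟨k, hk⟩ := ht ⟨a, ha⟩
    refine ⟨k, ?_⟩
    have := congrArg (fun v : V => ((v : A) : H)) hk
    simpa using this
  set j := V.index.factorial with hj
  have hj0 : j ≠ 0 := Nat.factorial_ne_zero _
  have hpow : ∀ a : A, a ^ j ∈ V := fun a =>
    Subgroup.pow_mem_of_index_ne_zero_of_dvd hV.index_ne_zero a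
      (fun m hm hm' => Nat.dvd_factorial hm hm')
  let S : Subgroup H := Subgroup.closure {w | ∃ x ∈ N, x ^ j = w}
  have hSn : S.Normal := by
    refine ⟨fun n hn g => ?_⟩
    induction hn using Subgroup.closure_induction with
    | mem x hx =>
      obtain ⟨w, hw, rfl⟩ := hx
      exact Subgroup.subset_closure ⟨g * w * g⁻¹, hNn.conj_mem w hw g, conj_pow⟩
    | one => simp [S.one_mem]
    | mul x y _ _ hx hy => rw [← conj_mul]; exact S.mul_mem hx hy
    | inv x _ hx => rw [← conj_inv]; exact S.inv_mem hx
  have hST : S ≤ Subgroup.zpowers T := by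
    rw [Subgroup.closure_le]
    rintro _ ⟨x, hx, rfl⟩
    obtain ⟨k, hk⟩ := hVT _ (hpow ⟨x, hle hx⟩)
    exact ⟨k, by simpa using hk⟩
  -- nontrivial element
  obtain ⟨z, hzN, hz1, k, hk⟩ : ∃ z ∈ N, z ≠ 1 ∧ ∃ k : ℤ, T ^ k = z := by
    obtain ⟨a, b, hab, he⟩ := Finite.exists_ne_map_eq_of_infinite
      (fun x : N => (QuotientGroup.mk (Subgroup.inclusion hle x) : A ⧸ V))
    rw [QuotientGroup.eq] at he
    obtain ⟨k, hk⟩ := hVT _ he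
    refine ⟨(a⁻¹ * b : N), SetLike.coe_mem _, ?_, k, by simpa using hk⟩
    intro h
    apply hab
    have : a⁻¹ * b = 1 := by exact_mod_cast h
    exact inv_mul_eq_one.1 this
  have hzS : z ^ j ∈ S := Subgroup.subset_closure ⟨z, hzN, rfl⟩
  have hScyc : ∃ s, Subgroup.zpowers s = S := by
    have hc : IsCyclic S := by
      have : IsCyclic (S.subgroupOf (Subgroup.zpowers T)) := inferInstance
      exact (Subgroup.subgroupOfEquivOfLe hST).isCyclic.1 this
    exact (Subgroup.isCyclic_iff_exists_zpowers_eq_top S).1 hc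
  obtain ⟨s, hs⟩ := hScyc
  refine ⟨s, ?_, hs ▸ hSn⟩
  rw [← hs] at hzS
  obtain ⟨m, hm⟩ := hzS
  simp only at hm
  by_contra hso
  have h1 : s ^ (orderOf s) = 1 := pow_orderOf_eq_one s
  have h2 : T ^ (k * j * orderOf s) = T ^ (0 : ℤ) := by
    rw [zpow_mul, zpow_mul, hk, zpow_natCast, zpow_natCast, ← hm, ← zpow_natCast, ← zpow_mul, mul_comm m, zpow_mul, zpow_natCast,
      h1, one_zpow, zpow_zero]
  have h3 := hTinj h2
  have hk0 : k ≠ 0 := by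
    rintro rfl
    exact hz1 (by rw [← hk, zpow_zero])
  have : (k * j * orderOf s : ℤ) ≠ 0 :=
    mul_ne_zero (mul_ne_zero hk0 (by exact_mod_cast hj0)) (by exact_mod_cast hso)
  exact this h3

end helpers

/-- If `Inn(G)` is infinite and `Aut(G)` is acylindrically hyperbolic, then every
subgroup of `Aut(G)` containing `Inn(G)` is acylindrically hyperbolic. -/
theorem subgroup_acylindricallyHyperbolic_of_le (G : Type u) [Group G]
    (hinf : Infinite ↥(MulAut.conj : G →* MulAut G).range)
    (hAut : AcylindricallyHyperbolic (MulAut G))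
    (A : Subgroup (MulAut G)) (hle : (MulAut.conj : G →* MulAut G).range ≤ A) :
    AcylindricallyHyperbolic ↥A := by
  obtain ⟨hnvc, Y, _, ρ, hY, hac, y, hunb⟩ := hAut
  have hNn : (MulAut.conj : G →* MulAut G).range.Normal := by
    refine ⟨?_⟩
    rintro _ ⟨a, rfl⟩ φ
    refine ⟨φ a, ?_⟩
    ext b
    simp [MulAut.conj_apply]
  refine ⟨fun hvc => ?_, Y, inferInstance, ρ.comp A.subtype, hY, ?_, y, ?_⟩
  · obtain ⟨s, hs, hsn⟩ := exists_cyclic_normal _ A hinf hle hvc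
    exact hnvc (virtuallyCyclic_of_normal ρ hY hac y hunb s hs hsn)
  · intro R hR
    obtain ⟨L, hL, N, hN⟩ := hac R hR
    refine ⟨L, hL, N, fun x y hxy => ?_⟩
    obtain ⟨S, hS, hS'⟩ := hN x y hxy
    classical
    refine ⟨S.preimage (fun a : A => (a : MulAut G)) Subtype.val_injective.injOn, ?_, ?_⟩
    · refine le_trans ?_ hS
      rw [← Finset.card_image_of_injective _ (Subtype.val_injective (p := fun a => a ∈ A))]
      apply Finset.card_le_card
      intro a ha
      obtain ⟨b, hb, rfl⟩ := Finset.mem_image.1 ha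
      exact Finset.mem_preimage.1 hb
    · intro g h1 h2
      exact Finset.mem_preimage.2 (hS' g h1 h2)
  · intro hb
    obtain ⟨C, hC⟩ := hb.subset_closedBall y
    obtain ⟨n, hn, hlt⟩ := normal_unbounded ρ hac y hunb (MulAut.conj : G →* MulAut G).range C
    have := hC ⟨⟨n, hle hn⟩, rfl⟩
    rw [Metric.mem_closedBall, dist_comm] at this
    exact absurd this (not_le.2 hlt)
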